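/- Let λ, μ, ν > 0 and set N₁ = (λ²−μ²+ν²)² + 4ν²(μ²−ν²), N₂ = (λ²+μ²−ν²)² − 4μ²(μ²−ν²), N₃ = (λ²+μ²+ν²)² − 4(λ⁴+μ²ν²). Then: (i) if μ < ν and λ² ≤ 2ν·√(ν²−μ²) + μ² − ν², then N₁ ≤ 0, and N₁ = 0 if and only if λ² = 2ν·√(ν²−μ²) + μ² − ν²; (ii) if ν < μ and λ² ≤ 2μ·√(μ²−ν²) + ν² − μ², then N₂ ≤ 0, and N₂ = 0 if and only if λ² = 2μ·√(μ²−ν²) + ν² − μ²; (iii) if λ² ≥ (1/3)·(2√(μ⁴−μ²ν²+ν⁴) + μ² + ν²), then N₃ ≤ 0, and N₃ = 0 if and only if λ² = (1/3)·(2√(μ⁴−μ²ν²+ν⁴) + μ² + ν²). -/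

import Mathlib

open Real

theorem sq_sub_sq_nonpos_and_eq_zero_iff {u v : ℝ} (hpos : 0 < u + v) (huv : u ≤ v) :
    u ^ 2 - v ^ 2 ≤ 0 ∧ (u ^ 2 - v ^ 2 = 0 ↔ u = v) := by
  rw [sq_sub_sq]
  exact ⟨mul_nonpos_of_nonneg_of_nonpos hpos.le (sub_nonpos.mpr huv),
    by rw [mul_eq_zero, or_iff_right hpos.ne', sub_eq_zero]⟩

theorem curvature_sign_conditions_riemannian_berger_sphere
    (l m n : ℝ) (hl : 0 < l) (hm : 0 < m) (hn : 0 < n)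
    (N₁ N₂ N₃ : ℝ)
    (hN₁ : N₁ = (l ^ 2 - m ^ 2 + n ^ 2) ^ 2 + 4 * n ^ 2 * (m ^ 2 - n ^ 2))
    (hN₂ : N₂ = (l ^ 2 + m ^ 2 - n ^ 2) ^ 2 - 4 * m ^ 2 * (m ^ 2 - n ^ 2))
    (hN₃ : N₃ = (l ^ 2 + m ^ 2 + n ^ 2) ^ 2 - 4 * (l ^ 4 + m ^ 2 * n ^ 2)) :
    (m < n → l ^ 2 ≤ 2 * n * Real.sqrt (n ^ 2 - m ^ 2) + m ^ 2 - n ^ 2 →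
      (N₁ ≤ 0 ∧ (N₁ = 0 ↔ l ^ 2 = 2 * n * Real.sqrt (n ^ 2 - m ^ 2) + m ^ 2 - n ^ 2))) ∧
    (n < m → l ^ 2 ≤ 2 * m * Real.sqrt (m ^ 2 - n ^ 2) + n ^ 2 - m ^ 2 →
      (N₂ ≤ 0 ∧ (N₂ = 0 ↔ l ^ 2 = 2 * m * Real.sqrt (m ^ 2 - n ^ 2) + n ^ 2 - m ^ 2))) ∧
    (l ^ 2 ≥ (1 / 3) * (2 * Real.sqrt (m ^ 4 - m ^ 2 * n ^ 2 + n ^ 4) + m ^ 2 + n ^ 2) →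
      (N₃ ≤ 0 ∧ (N₃ = 0 ↔
        l ^ 2 = (1 / 3) * (2 * Real.sqrt (m ^ 4 - m ^ 2 * n ^ 2 + n ^ 4) + m ^ 2 + n ^ 2)))) := by
  refine ⟨fun hmn h => ?_, fun hnm h => ?_, fun h => ?_⟩
  · have hd : 0 < n ^ 2 - m ^ 2 := by nlinarith
    have hs := Real.sq_sqrt hd.le
    set s := √(n ^ 2 - m ^ 2)
    have hpos : 0 < (l ^ 2 - m ^ 2 + n ^ 2) + 2 * n * s := by
      have : 0 ≤ 2 * n * s := by positivity
      nlinarith [sq_nonneg l]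
    obtain ⟨hle, hiff⟩ := sq_sub_sq_nonpos_and_eq_zero_iff hpos (by linarith)
    have hN : N₁ = (l ^ 2 - m ^ 2 + n ^ 2) ^ 2 - (2 * n * s) ^ 2 := by
      rw [hN₁, mul_pow, hs]; ring
    rw [hN]
    exact ⟨hle, hiff.trans ⟨fun _ => by linarith, fun _ => by linarith⟩⟩
  · have hd : 0 < m ^ 2 - n ^ 2 := by nlinarith
    have hs := Real.sq_sqrt hd.le
    set s := √(m ^ 2 - n ^ 2)
    have hpos : 0 < (l ^ 2 + m ^ 2 - n ^ 2) + 2 * m * s := by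
      have : 0 ≤ 2 * m * s := by positivity
      nlinarith [sq_nonneg l]
    obtain ⟨hle, hiff⟩ := sq_sub_sq_nonpos_and_eq_zero_iff hpos (by linarith)
    have hN : N₂ = (l ^ 2 + m ^ 2 - n ^ 2) ^ 2 - (2 * m * s) ^ 2 := by
      rw [hN₂, mul_pow, hs]; ring
    rw [hN]
    exact ⟨hle, hiff.trans ⟨fun _ => by linarith, fun _ => by linarith⟩⟩
  · have hd : 0 < m ^ 4 - m ^ 2 * n ^ 2 + n ^ 4 := by
      have : 0 < m ^ 2 * n ^ 2 := by positivity
      nlinarith [sq_nonneg (m ^ 2 - n ^ 2)]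
    have hs := Real.sq_sqrt hd.le
    have hs_pos := Real.sqrt_pos.mpr hd
    set s := √(m ^ 4 - m ^ 2 * n ^ 2 + n ^ 4)
    obtain ⟨hle, hiff⟩ := sq_sub_sq_nonpos_and_eq_zero_iff
      (u := 2 * s) (v := 3 * l ^ 2 - m ^ 2 - n ^ 2) (by linarith) (by linarith)
    have hN : 3 * N₃ = (2 * s) ^ 2 - (3 * l ^ 2 - m ^ 2 - n ^ 2) ^ 2 := by
      rw [hN₃, mul_pow, hs]; ring
    rw [← hN] at hle hiff
    refine ⟨by linarith, fun h0 => ?_, fun hl_eq => ?_⟩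
    · linarith [hiff.mp (by linarith)]
    · linarith [hiff.mpr (by linarith)]
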